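/- arXiv:1112.4042 — 2 statements merged into one kernel-verified Lean document; each statement's English description precedes it below -/
import Mathlib

section
/- Let m ≥ 2 be an integer and let w : [0,∞) → ℝ be a smooth warping function (w(0) = 0, w'(0) = 1, w(r) > 0 for all r > 0). If w''(r) > 0 for all r > 0, then the balance from below of the model M_w^m is sharp, i.e. q_w(r)·η_w(r) > 1/m for all r > 0. -/
theorem integral_pow_mul_deriv_eq {w : ℝ → ℝ} (hw : ContDiff ℝ 1 w) (hw0 : w 0 = 0)
    (n : ℕ) (r : ℝ) :
    ∫ t in (0:ℝ)..r, ((n + 1 : ℕ) : ℝ) * w t ^ n * deriv w t = w r ^ (n + 1) := by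
  have hd : ∀ t ∈ Set.uIcc 0 r,
      HasDerivAt (fun t => w t ^ (n + 1)) (((n + 1 : ℕ) : ℝ) * w t ^ n * deriv w t) t :=
    fun t _ => ((hw.differentiable one_ne_zero).differentiableAt (x := t)).hasDerivAt.pow (n + 1)
  have hc : Continuous fun t => ((n + 1 : ℕ) : ℝ) * w t ^ n * deriv w t :=
    (continuous_const.mul (hw.continuous.pow n)).mul (hw.continuous_deriv le_rfl)
  rw [intervalIntegral.integral_eq_sub_of_hasDerivAt hd (hc.intervalIntegrable 0 r)]
  simp [hw0]

theorem pow_succ_lt_mul_deriv_mul_integral {w : ℝ → ℝ} (hw : ContDiff ℝ 1 w) (hw0 : w 0 = 0)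
    (hwpos : ∀ r : ℝ, 0 < r → 0 < w r) (hmono : StrictMonoOn (deriv w) (Set.Ici 0))
    (n : ℕ) {r : ℝ} (hr : 0 < r) :
    w r ^ (n + 1) < ((n + 1 : ℕ) : ℝ) * deriv w r * ∫ t in (0:ℝ)..r, w t ^ n := by
  have hcw := hw.continuous
  have hcd := hw.continuous_deriv le_rfl
  have hn : (0 : ℝ) < ((n + 1 : ℕ) : ℝ) := by positivity
  rw [← integral_pow_mul_deriv_eq hw hw0, ← intervalIntegral.integral_const_mul]
  refine intervalIntegral.integral_lt_integral_of_continuousOn_of_le_of_exists_lt hr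
    (by fun_prop) (by fun_prop) (fun t ht => ?_) ⟨r / 2, ⟨by linarith, by linarith⟩, ?_⟩
  · have hle := hmono.monotoneOn ht.1.le hr.le ht.2
    have hpos := pow_pos (hwpos t ht.1) n
    rw [mul_right_comm]
    gcongr
  · have hlt := hmono (a := r / 2) (b := r) (half_pos hr).le hr.le (by linarith)
    have hpos := pow_pos (hwpos (r / 2) (by linarith)) n
    rw [mul_right_comm]
    gcongr



/-- If a smooth warping function `w` (with `w 0 = 0`, `w' 0 = 1`, `w > 0` on
`(0,∞)`) satisfies `w'' > 0` on `(0,∞)`, then the balance from below of the model `M_w^m`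
is sharp: `q_w(r) · η_w(r) > 1/m` for all `r > 0`. -/
theorem stmt_1 (m : ℕ) (hm : 2 ≤ m) (w : ℝ → ℝ)
    (hw_smooth : ContDiff ℝ (⊤ : ℕ∞) w)
    (hw0 : w 0 = 0) (hw'0 : deriv w 0 = 1)
    (hwpos : ∀ r : ℝ, 0 < r → 0 < w r)
    (hw'' : ∀ r : ℝ, 0 < r → 0 < deriv (deriv w) r) :
    ∀ r : ℝ, 0 < r →
      (1 : ℝ) / m <
        ((∫ t in (0:ℝ)..r, w t ^ (m - 1)) / w r ^ (m - 1)) * (deriv w r / w r) := by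
  intro r hr
  have hw : ContDiff ℝ 1 w := hw_smooth.of_le (by exact_mod_cast le_top)
  have hmono : StrictMonoOn (deriv w) (Set.Ici 0) :=
    strictMonoOn_of_deriv_pos (convex_Ici 0) (hw.continuous_deriv le_rfl).continuousOn
      fun t ht => hw'' t (by simpa using ht)
  obtain ⟨n, rfl⟩ : ∃ n, m = n + 1 := ⟨m - 1, by lia⟩
  have key := pow_succ_lt_mul_deriv_mul_integral hw hw0 hwpos hmono n hr
  have hpos := hwpos r hr
  have hn : (0 : ℝ) < ((n + 1 : ℕ) : ℝ) := by positivity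
  rw [Nat.add_sub_cancel, div_mul_div_comm, ← pow_succ, div_lt_div_iff₀ hn (by positivity)]
  linarith
end

section
/- Let m ≥ 2 be an integer and let w : [0,∞) → ℝ be a smooth warping function (w(0) = 0, w'(0) = 1, w(r) > 0 for all r > 0). If w(r)·w''(r) ≤ (w'(r))² for all r > 0 (equivalently, the radial curvature satisfies K_w(r) ≥ −η_w(r)², i.e. η_w is non-increasing), then the model M_w^m is balanced from above, i.e. q_w(r)·η_w(r) ≤ 1/(m−1) for all r > 0. -/
/-- If `w > 0` and `w * w'' ≤ (w')²` on `(0, ∞)`, then the logarithmic derivative `w' / w` is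
non-increasing there. -/
theorem antitoneOn_deriv_div_self {w : ℝ → ℝ} (hw : ContDiff ℝ 2 w)
    (hpos : ∀ r : ℝ, 0 < r → 0 < w r)
    (h : ∀ r : ℝ, 0 < r → w r * deriv (deriv w) r ≤ (deriv w r) ^ 2) :
    AntitoneOn (fun r => deriv w r / w r) (Set.Ioi 0) := by
  have hd : Differentiable ℝ w := hw.differentiable (by norm_num)
  have hd' : Differentiable ℝ (deriv w) := by
    have : ContDiff ℝ 1 (deriv w) :=
      ContDiff.deriv' (n := 1) (by simpa [one_add_one_eq_two] using hw)
    exact this.differentiable (by norm_num)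
  have hη : ∀ r ∈ Set.Ioi (0 : ℝ), HasDerivAt (fun r => deriv w r / w r)
      ((deriv (deriv w) r * w r - deriv w r * deriv w r) / w r ^ 2) r := fun r hr =>
    (hd' r).hasDerivAt.div (hd r).hasDerivAt (hpos r hr).ne'
  refine antitoneOn_of_deriv_nonpos (convex_Ioi 0)
    (fun r hr => (hη r hr).continuousAt.continuousWithinAt) ?_ ?_
  · rw [interior_Ioi]
    exact fun r hr => (hη r hr).differentiableAt.differentiableWithinAt
  · rw [interior_Ioi]
    intro r hr
    rw [(hη r hr).deriv]
    exact div_nonpos_of_nonpos_of_nonneg (by nlinarith [h r hr]) (sq_nonneg _)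

/-- If `w' / w` is non-increasing on `(0, ∞)`, then
`(∫₀ʳ w ^ (k + 1)) * (w' r / w r) ≤ ∫₀ʳ w ^ k * w' = w r ^ (k + 1) / (k + 1)`. -/
theorem integral_pow_mul_deriv_div_self_le {w : ℝ → ℝ} (hw : ContDiff ℝ 1 w) (hw0 : w 0 = 0)
    (hpos : ∀ r : ℝ, 0 < r → 0 < w r)
    (hη : AntitoneOn (fun r => deriv w r / w r) (Set.Ioi 0)) (k : ℕ) {r : ℝ} (hr : 0 < r) :
    (∫ t in (0:ℝ)..r, w t ^ (k + 1)) * (deriv w r / w r) ≤ w r ^ (k + 1) / (k + 1) := by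
  have hc : Continuous w := hw.continuous
  have hc' : Continuous (deriv w) := hw.continuous_deriv le_rfl
  have hint : ∫ t in (0:ℝ)..r, w t ^ k * deriv w t = w r ^ (k + 1) / (k + 1) := by
    rw [intervalIntegral.integral_eq_sub_of_hasDerivAt
      (f := fun t => w t ^ (k + 1) / (k + 1)) (fun t _ => ?_)
      (Continuous.intervalIntegrable (by fun_prop) _ _)]
    · simp [hw0]
    · have hk : (k : ℝ) + 1 ≠ 0 := by positivity
      refine ((((hw.differentiable (by norm_num)) t).hasDerivAt.fun_pow (k + 1)).div_const
        ((k : ℝ) + 1)).congr_deriv ?_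
      simp only [Nat.add_sub_cancel, Nat.cast_add, Nat.cast_one]
      rw [mul_assoc, mul_div_cancel_left₀ _ hk]
  rw [← intervalIntegral.integral_mul_const, ← hint]
  refine intervalIntegral.integral_mono_on_of_le_Ioo hr.le
    (Continuous.intervalIntegrable (by fun_prop) _ _)
    (Continuous.intervalIntegrable (by fun_prop) _ _) fun t ht => ?_
  have hwt := hpos t ht.1
  calc w t ^ (k + 1) * (deriv w r / w r)
      ≤ w t ^ (k + 1) * (deriv w t / w t) := by
        gcongr ?_ * ?_
        exact hη ht.1 hr ht.2.le
    _ = w t ^ k * deriv w t := by field_simp; ring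


/-- If a smooth warping function `w` (with `w 0 = 0`, `w' 0 = 1`, `w > 0` on
`(0,∞)`) satisfies `w·w'' ≤ (w')²` on `(0,∞)` (i.e. `η_w` is non-increasing), then the model
`M_w^m` is balanced from above: `q_w(r) · η_w(r) ≤ 1/(m-1)` for all `r > 0`. -/
theorem stmt_2 (m : ℕ) (hm : 2 ≤ m) (w : ℝ → ℝ)
    (hw_smooth : ContDiff ℝ (⊤ : ℕ∞) w)
    (hw0 : w 0 = 0) (hw'0 : deriv w 0 = 1)
    (hwpos : ∀ r : ℝ, 0 < r → 0 < w r)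
    (hww'' : ∀ r : ℝ, 0 < r → w r * deriv (deriv w) r ≤ (deriv w r) ^ 2) :
    ∀ r : ℝ, 0 < r →
      ((∫ t in (0:ℝ)..r, w t ^ (m - 1)) / w r ^ (m - 1)) * (deriv w r / w r) ≤
        1 / ((m : ℝ) - 1) := by
  intro r hr
  obtain ⟨k, rfl⟩ : ∃ k, m = k + 2 := ⟨m - 2, by omega⟩
  have hmain := integral_pow_mul_deriv_div_self_le (hw_smooth.of_le (by norm_cast))
    hw0 hwpos (antitoneOn_deriv_div_self (hw_smooth.of_le (by norm_cast))
      hwpos hww'') k hr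
  have hwk : 0 < w r ^ (k + 1) := pow_pos (hwpos r hr) _
  rw [show k + 2 - 1 = k + 1 from rfl, show ((k + 2 : ℕ) : ℝ) - 1 = k + 1 by push_cast; ring,
    div_mul_eq_mul_div, div_le_iff₀ hwk]
  exact hmain.trans_eq (by ring)
end
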